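/- In the stochastic SQP setting with pre-specified stepsizes described in the context, assume ν ∈ (0, σ/(2(κ_v(τ_min·L + Γ) + 4))], fix K ∈ ℕ with K ≥ 1 and η > 0 with η/√K ≤ κ_β, and let β_k := η/√K for all 0 ≤ k ≤ K−1. Set κ₂ := τ_min·(f(x₀) − f_low) + ‖c(x₀)‖₁ + η²·κ₁. Then (1/K)·∑_{k=0}^{K−1} 𝔼[‖c(x_k)‖₁] ≤ 2κ₂/(ν·σ·K). -/

import Mathlib

open Matrix MeasureTheory RealInnerProductSpace

/-- The ℓ¹-norm of a vector in `ℝ^m`. -/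
noncomputable def l1Norm {k : ℕ} (v : EuclideanSpace ℝ (Fin k)) : ℝ := ∑ i, |v i|

/-- The Jacobian matrix of `c` at `z`, whose rows are the gradients of the components. -/
noncomputable def Jmat {m n : ℕ}
    (gradc : Fin m → EuclideanSpace ℝ (Fin n) → EuclideanSpace ℝ (Fin n))
    (z : EuclideanSpace ℝ (Fin n)) : Matrix (Fin m) (Fin n) ℝ :=
  Matrix.of fun i j => gradc i z j

theorem l1Norm_nonneg {k : ℕ} (v : EuclideanSpace ℝ (Fin k)) : 0 ≤ l1Norm v :=
  Finset.sum_nonneg fun _ _ => abs_nonneg _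

theorem norm_le_l1Norm {k : ℕ} (v : EuclideanSpace ℝ (Fin k)) : ‖v‖ ≤ l1Norm v := by
  rw [EuclideanSpace.norm_eq]
  refine Real.sqrt_le_iff.2 ⟨l1Norm_nonneg v, ?_⟩
  simpa only [Real.norm_eq_abs, l1Norm] using
    Finset.sum_sq_le_sq_sum_of_nonneg (s := Finset.univ) fun i _ => abs_nonneg (v i)

theorem inner_toEuclideanLin_transpose {m n : ℕ} (A : Matrix (Fin m) (Fin n) ℝ)
    (z : EuclideanSpace ℝ (Fin n)) (y : EuclideanSpace ℝ (Fin m)) :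
    ⟪z, Matrix.toEuclideanLin Aᵀ y⟫ = ⟪Matrix.toEuclideanLin A z, y⟫ := by
  rw [← Matrix.conjTranspose_eq_transpose_of_trivial,
    Matrix.toEuclideanLin_conjTranspose_eq_adjoint, LinearMap.adjoint_inner_right]

theorem toEuclideanLin_Jmat_apply {m n : ℕ}
    (gradc : Fin m → EuclideanSpace ℝ (Fin n) → EuclideanSpace ℝ (Fin n))
    (z d : EuclideanSpace ℝ (Fin n)) (i : Fin m) :
    Matrix.toEuclideanLin (Jmat gradc z) d i = ⟪gradc i z, d⟫ := by
  simp [Jmat, Matrix.mulVec, dotProduct, PiLp.inner_apply, mul_comm]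

/-- Second-order Taylor bound for a function with Lipschitz gradient. -/
theorem taylor_le_of_lipschitz_gradient {E : Type*} [NormedAddCommGroup E]
    [InnerProductSpace ℝ E] [CompleteSpace E] {F : E → ℝ} {G : E → E} {L : ℝ}
    (hF : ∀ z, HasGradientAt F (G z) z) (hG : ∀ z z', ‖G z - G z'‖ ≤ L * ‖z - z'‖) (z d : E) :
    F (z + d) ≤ F z + ⟪G z, d⟫ + L / 2 * ‖d‖ ^ 2 := by
  set h : ℝ → ℝ := fun t => F (z + t • d) - t * ⟪G z, d⟫ - L / 2 * t ^ 2 * ‖d‖ ^ 2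
  have hderiv : ∀ t, HasDerivAt h (⟪G (z + t • d), d⟫ - ⟪G z, d⟫ - L * t * ‖d‖ ^ 2) t := by
    intro t
    have h1 : HasDerivAt (fun t : ℝ => z + t • d) d t := by
      simpa using ((hasDerivAt_id t).smul_const d).const_add z
    have h2 := (hF (z + t • d)).hasFDerivAt.comp_hasDerivAt t h1
    have h3 := (h2.sub ((hasDerivAt_id t).mul_const ⟪G z, d⟫)).sub
      ((((hasDerivAt_id t).pow 2).const_mul (L / 2)).mul_const (‖d‖ ^ 2))
    refine h3.congr_deriv ?_
    simp only [InnerProductSpace.toDual_apply_apply, id_eq]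
    norm_num
    exact Or.inl (by ring)
  have hanti : AntitoneOn h (Set.Icc 0 1) := by
    refine antitoneOn_of_deriv_nonpos (convex_Icc 0 1)
      (fun t _ => (hderiv t).continuousAt.continuousWithinAt)
      (fun t _ => (hderiv t).differentiableAt.differentiableWithinAt) fun t ht => ?_
    rw [interior_Icc] at ht
    rw [(hderiv t).deriv, ← inner_sub_left]
    have h1 := real_inner_le_norm (G (z + t • d) - G z) d
    have h2 := hG (z + t • d) z
    rw [add_sub_cancel_left, norm_smul, Real.norm_eq_abs, abs_of_pos ht.1] at h2
    nlinarith [mul_le_mul_of_nonneg_right h2 (norm_nonneg d)]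
  have := hanti (Set.left_mem_Icc.2 zero_le_one) (Set.right_mem_Icc.2 zero_le_one) zero_le_one
  simp only [h] at this
  simp at this
  linarith

theorem abs_taylor_le_of_lipschitz_gradient {E : Type*} [NormedAddCommGroup E]
    [InnerProductSpace ℝ E] [CompleteSpace E] {F : E → ℝ} {G : E → E} {L : ℝ}
    (hF : ∀ z, HasGradientAt F (G z) z) (hG : ∀ z z', ‖G z - G z'‖ ≤ L * ‖z - z'‖) (z d : E) :
    |F (z + d)| ≤ |F z + ⟪G z, d⟫| + L / 2 * ‖d‖ ^ 2 := by
  have h1 := taylor_le_of_lipschitz_gradient hF hG z d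
  have h2 := taylor_le_of_lipschitz_gradient (F := fun z => -F z) (G := fun z => -G z) (L := L)
    (fun z => by
      rw [hasGradientAt_iff_hasFDerivAt, map_neg]
      exact (hF z).hasFDerivAt.neg)
    (fun z z' => by
      rw [← neg_sub', norm_neg]
      exact hG z z') z d
  rw [inner_neg_left] at h2
  rw [abs_le]
  constructor
  · linarith [neg_abs_le (F z + ⟪G z, d⟫)]
  · linarith [le_abs_self (F z + ⟪G z, d⟫)]

/-- Decrease of the constraint violation along a step that satisfies the linearized
constraints. -/
theorem l1Norm_add_smul_le {m n : ℕ} {c : EuclideanSpace ℝ (Fin n) → EuclideanSpace ℝ (Fin m)}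
    {gradc : Fin m → EuclideanSpace ℝ (Fin n) → EuclideanSpace ℝ (Fin n)} {γ : Fin m → ℝ}
    (hc : ∀ i z, HasGradientAt (fun w => c w i) (gradc i z) z)
    (hcLip : ∀ i z z', ‖gradc i z - gradc i z'‖ ≤ γ i * ‖z - z'‖)
    {z d : EuclideanSpace ℝ (Fin n)}
    (hd : Matrix.toEuclideanLin (Jmat gradc z) d = -c z) (a : ℝ) :
    l1Norm (c (z + a • d)) ≤ |1 - a| * l1Norm (c z) + (∑ i, γ i) / 2 * (a ^ 2 * ‖d‖ ^ 2) := by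
  unfold l1Norm
  rw [Finset.mul_sum, div_mul_eq_mul_div, Finset.sum_mul, Finset.sum_div,
    ← Finset.sum_add_distrib]
  refine Finset.sum_le_sum fun i _ => ?_
  have h := abs_taylor_le_of_lipschitz_gradient (hc i) (hcLip i) z (a • d)
  have hi : ⟪gradc i z, d⟫ = -c z i := by
    rw [← toEuclideanLin_Jmat_apply, hd, PiLp.neg_apply]
  rw [inner_smul_right, hi, norm_smul, mul_pow, Real.norm_eq_abs, sq_abs] at h
  rw [← abs_mul, show (1 - a) * c z i = c z i + a * -c z i by ring]
  linarith

theorem stronglyMeasurable_det {Ω ι : Type*} [Fintype ι] [DecidableEq ι] {m0 : MeasurableSpace Ω}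
    {A : Ω → Matrix ι ι ℝ} (hA : ∀ i j, StronglyMeasurable fun ω => A ω i j) :
    StronglyMeasurable fun ω => (A ω).det := by
  simp only [Matrix.det_apply]
  exact Finset.stronglyMeasurable_fun_sum _ fun p _ =>
    (Finset.stronglyMeasurable_fun_prod _ fun i _ => hA (p i) i).const_smul _

theorem stronglyMeasurable_inv_apply {Ω ι : Type*} [Fintype ι] [DecidableEq ι]
    {m0 : MeasurableSpace Ω} {A : Ω → Matrix ι ι ℝ}
    (hA : ∀ i j, StronglyMeasurable fun ω => A ω i j) (i j : ι) :
    StronglyMeasurable fun ω => (A ω)⁻¹ i j := by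
  simp only [Matrix.inv_def, Ring.inverse_eq_inv', Matrix.smul_apply, smul_eq_mul,
    Matrix.adjugate_apply]
  refine ((stronglyMeasurable_det hA).measurable.inv.stronglyMeasurable).mul
    (stronglyMeasurable_det fun k l => ?_)
  by_cases hk : k = j
  · simpa [Matrix.updateRow_apply, hk] using stronglyMeasurable_const
  · simpa [Matrix.updateRow_apply, hk] using hA k l

/-- The saddle point system is uniquely solvable, and its solution depends measurably on the
matrices: every linear functional of the solution is represented by a measurable vector. -/
theorem exists_stronglyMeasurable_inner_saddle_eq {m n : ℕ} {Ω : Type*} {m0 : MeasurableSpace Ω}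
    {H : Ω → Matrix (Fin n) (Fin n) ℝ} {J : Ω → Matrix (Fin m) (Fin n) ℝ} {ζ s : ℝ}
    (hζ : 0 < ζ) (hs : 0 < s)
    (hH : ∀ i j, StronglyMeasurable fun ω => H ω i j)
    (hJ : ∀ i j, StronglyMeasurable fun ω => J ω i j)
    (hpd : ∀ ω (z : EuclideanSpace ℝ (Fin n)), Matrix.toEuclideanLin (J ω) z = 0 →
      ζ * ‖z‖ ^ 2 ≤ ⟪z, Matrix.toEuclideanLin (H ω) z⟫)
    (hsv : ∀ ω (z : EuclideanSpace ℝ (Fin m)),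
      s * ‖z‖ ≤ ‖Matrix.toEuclideanLin (J ω)ᵀ z‖)
    {b : Ω → EuclideanSpace ℝ (Fin n)} (hb : StronglyMeasurable b) :
    ∃ a : Ω → EuclideanSpace ℝ (Fin n), StronglyMeasurable a ∧
      ∀ ω (w e : EuclideanSpace ℝ (Fin n)) (q : EuclideanSpace ℝ (Fin m)),
        Matrix.toEuclideanLin (J ω) w = 0 →
        Matrix.toEuclideanLin (H ω) w + Matrix.toEuclideanLin (J ω)ᵀ q = e →
        ⟪b ω, w⟫ = ⟪a ω, e⟫ := by
  set A : Ω → Matrix (Fin n ⊕ Fin m) (Fin n ⊕ Fin m) ℝ :=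
    fun ω => Matrix.fromBlocks (H ω) (J ω)ᵀ (J ω) 0 with hAdef
  have hA : ∀ i j, StronglyMeasurable fun ω => A ω i j := by
    rintro (i | i) (j | j)
    · exact hH i j
    · exact hJ j i
    · exact hJ i j
    · exact stronglyMeasurable_const
  have hdet : ∀ ω, IsUnit (A ω).det := by
    intro ω
    rw [isUnit_iff_ne_zero]
    intro h0
    obtain ⟨r, hr0, hr⟩ := Matrix.exists_mulVec_eq_zero_iff.2 h0
    rw [hAdef, Matrix.fromBlocks_mulVec] at hr
    set z : EuclideanSpace ℝ (Fin n) := WithLp.toLp 2 (r ∘ Sum.inl) with hz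
    set q : EuclideanSpace ℝ (Fin m) := WithLp.toLp 2 (r ∘ Sum.inr) with hq
    have h1 : Matrix.toEuclideanLin (H ω) z + Matrix.toEuclideanLin (J ω)ᵀ q = 0 := by
      ext i
      simpa using congrFun hr (Sum.inl i)
    have h2 : Matrix.toEuclideanLin (J ω) z = 0 := by
      ext i
      simpa using congrFun hr (Sum.inr i)
    have hz0 : z = 0 := by
      have h3 := hpd ω z h2
      rw [eq_neg_of_add_eq_zero_left h1, inner_neg_right, inner_toEuclideanLin_transpose, h2,
        inner_zero_left, neg_zero] at h3
      have : ‖z‖ ^ 2 ≤ 0 := by nlinarith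
      simpa using le_antisymm this (sq_nonneg _)
    have hq0 : q = 0 := by
      have h3 := hsv ω q
      rw [hz0, map_zero, zero_add] at h1
      rw [h1, norm_zero] at h3
      have : ‖q‖ ≤ 0 := by nlinarith
      simpa using this
    refine hr0 (funext ?_)
    rintro (i | i)
    · simpa [hz] using congrArg (fun t : EuclideanSpace ℝ (Fin n) => t i) hz0
    · simpa [hq] using congrArg (fun t : EuclideanSpace ℝ (Fin m) => t i) hq0
  refine ⟨fun ω => WithLp.toLp 2 fun j => ∑ i, b ω i * (A ω)⁻¹ (Sum.inl i) (Sum.inl j), ?_, ?_⟩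
  · refine (PiLp.continuous_toLp 2 _).comp_stronglyMeasurable ?_
    refine (measurable_pi_lambda _ fun j => ?_).stronglyMeasurable
    refine (Finset.stronglyMeasurable_fun_sum _ fun i _ => ?_).measurable
    exact (((PiLp.continuous_apply 2 _ i).comp_stronglyMeasurable hb)).mul
      (stronglyMeasurable_inv_apply hA _ _)
  · intro ω w e q hw he
    have hsol : A ω *ᵥ Sum.elim w.ofLp q.ofLp = Sum.elim e.ofLp 0 := by
      rw [hAdef, Matrix.fromBlocks_mulVec]
      funext i
      rcases i with i | i
      · simpa using congrArg (fun t : EuclideanSpace ℝ (Fin n) => t i) he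
      · simpa using congrArg (fun t : EuclideanSpace ℝ (Fin m) => t i) hw
    have hw' : ∀ i, w i = ∑ j, (A ω)⁻¹ (Sum.inl i) (Sum.inl j) * e j := by
      intro i
      have := congrFun (congrArg ((A ω)⁻¹ *ᵥ ·) hsol) (Sum.inl i)
      rw [Matrix.mulVec_mulVec, Matrix.nonsing_inv_mul _ (hdet ω), Matrix.one_mulVec] at this
      simpa [Matrix.mulVec, dotProduct] using this
    simp only [PiLp.inner_apply, RCLike.inner_apply, conj_trivial]
    simp only [hw', Finset.mul_sum, Finset.sum_mul]
    rw [Finset.sum_comm]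
    exact Finset.sum_congr rfl fun _ _ => Finset.sum_congr rfl fun _ _ => by ring

/-- The tangential part of a saddle point solution is controlled by the right-hand side. -/
theorem tangential_norm_le {m n : ℕ} {H : Matrix (Fin n) (Fin n) ℝ}
    {J : Matrix (Fin m) (Fin n) ℝ} {ζ : ℝ}
    (hpd : ∀ z : EuclideanSpace ℝ (Fin n), Matrix.toEuclideanLin J z = 0 →
      ζ * ‖z‖ ^ 2 ≤ ⟪z, Matrix.toEuclideanLin H z⟫)
    {w e : EuclideanSpace ℝ (Fin n)} {q : EuclideanSpace ℝ (Fin m)}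
    (hw : Matrix.toEuclideanLin J w = 0)
    (he : Matrix.toEuclideanLin H w + Matrix.toEuclideanLin Jᵀ q = -e) :
    ζ * ‖w‖ ≤ ‖e‖ := by
  have h1 := hpd w hw
  rw [eq_sub_of_add_eq he, inner_sub_right, inner_toEuclideanLin_transpose, hw, inner_zero_left,
    sub_zero, inner_neg_right] at h1
  have h2 := neg_le_of_abs_le (abs_real_inner_le_norm w e)
  rcases eq_or_lt_of_le (norm_nonneg w) with h0 | h0
  · rw [← h0, mul_zero]
    exact norm_nonneg e
  · refine le_of_mul_le_mul_left ?_ h0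
    nlinarith

/-- The component of a step in the range of `Jᵀ` is controlled by the constraint value. -/
theorem normal_norm_le {m n : ℕ} {J : Matrix (Fin m) (Fin n) ℝ} {s : ℝ}
    (hsv : ∀ z : EuclideanSpace ℝ (Fin m), s * ‖z‖ ≤ ‖Matrix.toEuclideanLin Jᵀ z‖)
    (hs : 0 < s) {v : EuclideanSpace ℝ (Fin n)} {b : EuclideanSpace ℝ (Fin m)}
    (hv : ∃ z, v = Matrix.toEuclideanLin Jᵀ z) (hJv : Matrix.toEuclideanLin J v = -b) :
    s * ‖v‖ ≤ ‖b‖ := by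
  obtain ⟨z, hz⟩ := hv
  have h1 := hsv z
  rw [← hz] at h1
  have h2 : ‖v‖ ^ 2 ≤ ‖b‖ * ‖z‖ := by
    rw [← real_inner_self_eq_norm_sq]
    nth_rewrite 2 [hz]
    rw [inner_toEuclideanLin_transpose, hJv, ← norm_neg b]
    exact real_inner_le_norm _ _
  rcases eq_or_lt_of_le (norm_nonneg v) with h0 | h0
  · rw [← h0, mul_zero]
    exact norm_nonneg b
  · refine le_of_mul_le_mul_right ?_ h0
    nlinarith [mul_le_mul_of_nonneg_left h1 (norm_nonneg b),
      mul_le_mul_of_nonneg_left h2 hs.le]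

theorem merit_decrease_le {τ L Γ κv κc ν θ κβ σ κg F F' C C' a b U V gu gw gv W : ℝ}
    (hτ : 0 ≤ τ) (hA : 0 ≤ τ * L + Γ) (hκv : 0 ≤ κv) (hθ : 0 ≤ θ) (hν : 0 < ν)
    (hκg : 0 ≤ κg)
    (hσ : 0 ≤ σ) (hb : 0 < b) (hbκ : b ≤ κβ) (ha : ν ≤ a) (ha' : a ≤ ν + θ * b)
    (hC : 0 ≤ C) (hCκ : C ≤ κc) (hU : 0 ≤ U) (hV : V ≤ κv * C)
    (hνσ : ν * (κv * (τ * L + Γ) + 4) ≤ σ / 2)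
    (hF : F' ≤ F + a * (b * (gu + gw) + gv) + L / 2 * (a ^ 2 * (b ^ 2 * U + V)))
    (hC' : C' ≤ |1 - a| * C + Γ / 2 * (a ^ 2 * (b ^ 2 * U + V)))
    (hg : τ * (b * gu + gv) ≤ (1 - σ) * C) (hW : gw ≤ κg * W) (hW0 : 0 ≤ W) :
    τ * F' + C' ≤ τ * F + C - ν * σ / 2 * C + ν * τ * b * gw
      + b ^ 2 * ((ν + θ * κβ) ^ 2 * (τ * L + Γ) / 2 * U
        + (θ * (θ * κc * (κv * (τ * L + Γ) + 4)) + θ * τ * κg * W)) := by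
  have ha0 : 0 < a := hν.trans_le ha
  set A := τ * L + Γ with hAdef
  have h1 : |1 - a| * C ≤ (1 - a + a ^ 2 / 2) * C := by
    refine mul_le_mul_of_nonneg_right (abs_le.2 ⟨?_, ?_⟩) hC
    · nlinarith [sq_nonneg (a - 2)]
    · nlinarith [sq_nonneg a]
  have h2 : a * (τ * (b * gu + gv)) ≤ a * ((1 - σ) * C) := mul_le_mul_of_nonneg_left hg ha0.le
  have h2' : ν * (σ * C) ≤ a * (σ * C) := mul_le_mul_of_nonneg_right ha (mul_nonneg hσ hC)
  have h3 : (a - ν) * (τ * b * gw) ≤ θ * b * (τ * b * (κg * W)) := by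
    refine (mul_le_mul_of_nonneg_left
      (mul_le_mul_of_nonneg_left hW (by positivity)) (by linarith)).trans ?_
    exact mul_le_mul_of_nonneg_right (by linarith) (by positivity)
  have h4 : a ^ 2 * (A / 2 * (b ^ 2 * U)) ≤ (ν + θ * κβ) ^ 2 * (A / 2 * (b ^ 2 * U)) := by
    refine mul_le_mul_of_nonneg_right ?_ (by positivity)
    exact pow_le_pow_left₀ ha0.le (ha'.trans (by gcongr)) 2
  have h5 : a ^ 2 ≤ 2 * ν ^ 2 + 2 * (θ * b) ^ 2 := by
    have : a ^ 2 ≤ (ν + θ * b) ^ 2 := pow_le_pow_left₀ ha0.le ha' 2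
    nlinarith [sq_nonneg (ν - θ * b)]
  have h6 : a ^ 2 * (A / 2 * V) ≤ a ^ 2 * (A / 2 * (κv * C)) := by gcongr
  have h7 : a ^ 2 * ((κv * A + 1) / 2 * C) ≤
      (2 * ν ^ 2 + 2 * (θ * b) ^ 2) * ((κv * A + 4) / 2 * C) := by
    refine mul_le_mul h5 ?_ (by positivity) (by positivity)
    gcongr
    norm_num
  have h8 : ν * (κv * A + 4) * (ν * C) ≤ σ / 2 * (ν * C) :=
    mul_le_mul_of_nonneg_right hνσ (by positivity)
  have h9 : (θ * b) ^ 2 * (κv * A + 4) * C ≤ (θ * b) ^ 2 * (κv * A + 4) * κc := by gcongr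
  have h10 := mul_le_mul_of_nonneg_left hF hτ
  have h11 : (τ * L + Γ) / 2 * (a ^ 2 * (b ^ 2 * U + V))
      = a ^ 2 * (A / 2 * (b ^ 2 * U)) + a ^ 2 * (A / 2 * V) := by rw [← hAdef]; ring
  linarith

/-- A conditionally centred error is orthogonal in mean to every measurable vector. -/
theorem integral_inner_eq_zero_of_condExp_eq_zero {E Ω : Type*} [NormedAddCommGroup E]
    [InnerProductSpace ℝ E] [CompleteSpace E] {m m0 : MeasurableSpace Ω} (hm : m ≤ m0)
    {μ : Measure Ω} [IsFiniteMeasure μ] {a e : Ω → E} (ha : StronglyMeasurable[m] a)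
    (he : Integrable e μ) (hae : Integrable (fun ω => ⟪a ω, e ω⟫) μ) (hce : μ[e | m] =ᵐ[μ] 0) :
    ∫ ω, ⟪a ω, e ω⟫ ∂μ = 0 := by
  have h := condExp_bilin_of_stronglyMeasurable_left (innerSL ℝ) ha hae he
  rw [← integral_condExp hm, integral_eq_zero_of_ae]
  filter_upwards [h, hce] with ω h1 h2
  refine h1.trans ?_
  simp [h2]

/-- Bounds on the normal step `v` and on the tangential step `p` computed from a vector `b`
with `‖b‖ ≤ κg`. -/
theorem sqp_step_bounds {m n : ℕ} {H : Matrix (Fin n) (Fin n) ℝ} {J : Matrix (Fin m) (Fin n) ℝ}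
    {ζ s κH κg κc κv κu : ℝ} (hζ : 0 < ζ) (hs : 0 < s) (hκH : 0 ≤ κH) (hκg : 0 ≤ κg)
    (hκv : κv = max (1 / s) (κc / s ^ 2)) (hκu : κu = ζ⁻¹ * κg + ζ⁻¹ * κH * κv * κc)
    (hHnorm : ∀ z : EuclideanSpace ℝ (Fin n), ‖Matrix.toEuclideanLin H z‖ ≤ κH * ‖z‖)
    (hpd : ∀ z : EuclideanSpace ℝ (Fin n), Matrix.toEuclideanLin J z = 0 →
      ζ * ‖z‖ ^ 2 ≤ ⟪z, Matrix.toEuclideanLin H z⟫)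
    (hsv : ∀ z : EuclideanSpace ℝ (Fin m), s * ‖z‖ ≤ ‖Matrix.toEuclideanLin Jᵀ z‖)
    {b p v : EuclideanSpace ℝ (Fin n)} {r q : EuclideanSpace ℝ (Fin m)}
    (hb : ‖b‖ ≤ κg) (hr : l1Norm r ≤ κc)
    (hv : ∃ z, v = Matrix.toEuclideanLin Jᵀ z) (hJv : Matrix.toEuclideanLin J v = -r)
    (hJp : Matrix.toEuclideanLin J p = 0)
    (hsys : Matrix.toEuclideanLin H (p + v) + Matrix.toEuclideanLin Jᵀ q = -b) :
    ‖v‖ ^ 2 ≤ κv * l1Norm r ∧ ‖p‖ ≤ κu ∧ ‖p‖ ^ 2 ≤ ζ⁻¹ * κH * κu ^ 2 ∧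
      ⟪b, p⟫ ≤ κu * (κH * (κv * l1Norm r)) ∧ ⟪b, v⟫ ≤ κg * (κv * l1Norm r) := by
  have hC0 : 0 ≤ l1Norm r := l1Norm_nonneg r
  have hκv0 : 0 ≤ κv := hκv ▸ le_max_of_le_left (by positivity)
  have hsv' : s * ‖v‖ ≤ l1Norm r := (normal_norm_le hsv hs hv hJv).trans (norm_le_l1Norm _)
  have hvle : ‖v‖ ≤ κv * l1Norm r := by
    refine le_trans ?_ (mul_le_mul_of_nonneg_right (hκv ▸ le_max_left _ _) hC0)
    rwa [one_div, inv_mul_eq_div, le_div_iff₀' hs]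
  have hvsq : ‖v‖ ^ 2 ≤ κv * l1Norm r := by
    refine le_trans ?_ (mul_le_mul_of_nonneg_right (hκv ▸ le_max_right _ _) hC0)
    rw [div_mul_eq_mul_div, le_div_iff₀' (by positivity), ← mul_pow, sq]
    exact mul_le_mul (hsv'.trans hr) hsv' (by positivity) (hC0.trans hr)
  have hHv : ‖Matrix.toEuclideanLin H v‖ ≤ κH * (κv * l1Norm r) :=
    (hHnorm v).trans (mul_le_mul_of_nonneg_left hvle hκH)
  have hp : ‖p‖ ≤ κu := by
    have h1 := tangential_norm_le hpd hJp (q := q) (e := b + Matrix.toEuclideanLin H v) (by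
      rw [neg_add, ← hsys, map_add]
      abel)
    have h2 := norm_add_le b (Matrix.toEuclideanLin H v)
    have h3 : κH * (κv * l1Norm r) ≤ κH * (κv * κc) := by gcongr
    have h4 : κu = ζ⁻¹ * (κg + κH * (κv * κc)) := by rw [hκu]; ring
    rw [h4, inv_mul_eq_div, le_div_iff₀' hζ]
    linarith
  have hκu0 : 0 ≤ κu := (norm_nonneg p).trans hp
  refine ⟨hvsq, hp, ?_, ?_, ?_⟩
  · rw [mul_assoc, inv_mul_eq_div, le_div_iff₀' hζ]
    calc ζ * ‖p‖ ^ 2 ≤ ⟪p, Matrix.toEuclideanLin H p⟫ := hpd p hJp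
      _ ≤ ‖p‖ * ‖Matrix.toEuclideanLin H p‖ := real_inner_le_norm _ _
      _ ≤ ‖p‖ * (κH * ‖p‖) := mul_le_mul_of_nonneg_left (hHnorm p) (norm_nonneg p)
      _ = κH * ‖p‖ ^ 2 := by ring
      _ ≤ κH * κu ^ 2 := by gcongr
  · rw [real_inner_comm, ← neg_neg b, ← hsys, inner_neg_right, inner_add_right,
      inner_toEuclideanLin_transpose, hJp, inner_zero_left, add_zero, map_add, inner_add_right]
    have h3 := (mul_nonneg hζ.le (sq_nonneg ‖p‖)).trans (hpd p hJp)
    have h4 := neg_le_of_abs_le (abs_real_inner_le_norm p (Matrix.toEuclideanLin H v))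
    have h5 := mul_le_mul hp hHv (norm_nonneg _) hκu0
    linarith
  · exact (real_inner_le_norm _ _).trans (mul_le_mul hb hvle (norm_nonneg _) hκg)

theorem integral_le_of_le_add_error {Ω : Type*} {m0 : MeasurableSpace Ω} {μ : Measure Ω}
    [IsProbabilityMeasure μ] {X' X C G I E : Ω → ℝ} {p q r t a M : ℝ}
    (hX' : Integrable X' μ) (hX : Integrable X μ) (hC : Integrable C μ) (hG : Integrable G μ)
    (hI : Integrable I μ) (hE : Integrable E μ) (hG0 : ∫ ω, G ω ∂μ = 0)
    (hI0 : ∫ ω, I ω ∂μ = 0) (hEM : ∫ ω, E ω ∂μ ≤ M) (ht : 0 ≤ t)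
    (h : ∀ ω, X' ω ≤ X ω - p * C ω + q * G ω + r * I ω + t * E ω + a) :
    ∫ ω, X' ω ∂μ ≤ (∫ ω, X ω ∂μ) - p * (∫ ω, C ω ∂μ) + t * M + a := by
  have h1 := integral_mono hX' (by fun_prop) h
  rw [integral_add (by fun_prop) (by fun_prop), integral_add (by fun_prop) (by fun_prop),
    integral_add (by fun_prop) (by fun_prop), integral_add (by fun_prop) (by fun_prop),
    integral_sub (by fun_prop) (by fun_prop), integral_const_mul, integral_const_mul,
    integral_const_mul, integral_const_mul, hG0, hI0] at h1
  have h2 := mul_le_mul_of_nonneg_left hEM ht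
  simp only [integral_const, probReal_univ, one_smul, mul_zero, add_zero] at h1
  linarith

/-- One-step decrease of the merit function, with the tangential step `p + w` split into its
noiseless part `p` and a perturbation `w` controlled by the gradient error. -/
theorem merit_step_le {m n : ℕ}
    {f : EuclideanSpace ℝ (Fin n) → ℝ} {gradf : EuclideanSpace ℝ (Fin n) → EuclideanSpace ℝ (Fin n)}
    {c : EuclideanSpace ℝ (Fin n) → EuclideanSpace ℝ (Fin m)}
    {gradc : Fin m → EuclideanSpace ℝ (Fin n) → EuclideanSpace ℝ (Fin n)} {γ : Fin m → ℝ}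
    {τ L κv κc ν θ κβ σ κg ζ a b M B ε : ℝ}
    (hf : ∀ z, HasGradientAt f (gradf z) z)
    (hfLip : ∀ z z', ‖gradf z - gradf z'‖ ≤ L * ‖z - z'‖)
    (hc : ∀ i z, HasGradientAt (fun w => c w i) (gradc i z) z)
    (hcLip : ∀ i z z', ‖gradc i z - gradc i z'‖ ≤ γ i * ‖z - z'‖)
    (hτ : 0 ≤ τ) (hA : 0 ≤ τ * L + ∑ i, γ i) (hκv : 0 ≤ κv) (hθ : 0 ≤ θ) (hν : 0 < ν)
    (hκg : 0 ≤ κg) (hσ : 0 ≤ σ) (hζ : 0 < ζ) (hM : 0 < M)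
    (hb : 0 < b) (hbκ : b ≤ κβ) (ha : ν ≤ a) (ha' : a ≤ ν + θ * b)
    (hνσ : ν * (κv * (τ * L + ∑ i, γ i) + 4) ≤ σ / 2)
    {z p w v : EuclideanSpace ℝ (Fin n)}
    (hg : ‖gradf z‖ ≤ κg) (hcz : l1Norm (c z) ≤ κc)
    (hJu : Matrix.toEuclideanLin (Jmat gradc z) (p + w) = 0)
    (hv : ∃ q, v = Matrix.toEuclideanLin (Jmat gradc z)ᵀ q)
    (hJv : Matrix.toEuclideanLin (Jmat gradc z) v = -c z)
    (hvsq : ‖v‖ ^ 2 ≤ κv * l1Norm (c z)) (hpsq : ‖p‖ ^ 2 ≤ B) (hwε : ‖w‖ ≤ ζ⁻¹ * ε)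
    (hmodel : τ * (b * ⟪gradf z, p⟫ + ⟪gradf z, v⟫) ≤ (1 - σ) * l1Norm (c z)) :
    τ * f (z + a • (b • (p + w) + v)) + l1Norm (c (z + a • (b • (p + w) + v))) ≤
      τ * f z + l1Norm (c z) - ν * σ / 2 * l1Norm (c z) + ν * τ * b * ⟪gradf z, w⟫
      + b ^ 2 * ((ν + θ * κβ) ^ 2 * (τ * L + ∑ i, γ i)) * ⟪p, w⟫
      + b ^ 2 * ((ν + θ * κβ) ^ 2 * (τ * L + ∑ i, γ i) / 2 * ζ⁻¹ ^ 2
          + θ * τ * κg * ζ⁻¹ / (2 * √M)) * ε ^ 2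
      + b ^ 2 * ((ν + θ * κβ) ^ 2 * (τ * L + ∑ i, γ i) / 2 * B
          + θ * (θ * κc * (κv * (τ * L + ∑ i, γ i) + 4)) + θ * τ * κg * ζ⁻¹ * √M / 2) := by
  have huv : ⟪p + w, v⟫ = 0 := by
    obtain ⟨q, rfl⟩ := hv
    rw [inner_toEuclideanLin_transpose, hJu, inner_zero_left]
  have hdsq : ‖b • (p + w) + v‖ ^ 2 = b ^ 2 * ‖p + w‖ ^ 2 + ‖v‖ ^ 2 := by
    rw [norm_add_sq_real, inner_smul_left, huv, norm_smul, mul_pow, Real.norm_eq_abs, sq_abs]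
    ring
  have hF := taylor_le_of_lipschitz_gradient hf hfLip z (a • (b • (p + w) + v))
  rw [norm_smul, mul_pow, hdsq, Real.norm_eq_abs, sq_abs, inner_smul_right,
    inner_add_right, inner_smul_right, inner_add_right] at hF
  have hCd := l1Norm_add_smul_le hc hcLip (z := z) (d := b • (p + w) + v)
    (by rw [map_add, map_smul, hJu, smul_zero, zero_add, hJv]) a
  rw [hdsq] at hCd
  refine (merit_decrease_le hτ hA hκv hθ hν hκg hσ hb hbκ ha ha' (l1Norm_nonneg _) hcz
    (sq_nonneg _) hvsq hνσ hF hCd hmodel ((real_inner_le_norm _ w).trans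
      (mul_le_mul_of_nonneg_right hg (norm_nonneg _))) (norm_nonneg _)).trans ?_
  have hM' : 0 < √M := Real.sqrt_pos.2 hM
  have hyoung : ε ≤ ε ^ 2 / (2 * √M) + √M / 2 := by
    rw [div_add_div _ _ (by positivity) two_ne_zero, le_div_iff₀ (by positivity)]
    linarith [sq_nonneg (ε - √M)]
  have h1 : (ν + θ * κβ) ^ 2 * (τ * L + ∑ i, γ i) / 2 * ‖p + w‖ ^ 2 ≤
      (ν + θ * κβ) ^ 2 * (τ * L + ∑ i, γ i) / 2 * (B + 2 * ⟪p, w⟫ + ζ⁻¹ ^ 2 * ε ^ 2) := by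
    refine mul_le_mul_of_nonneg_left ?_ (by positivity)
    rw [norm_add_sq_real, ← mul_pow]
    linarith [pow_le_pow_left₀ (norm_nonneg _) hwε 2]
  have h2 : θ * τ * κg * ‖w‖ ≤ θ * τ * κg * (ζ⁻¹ * (ε ^ 2 / (2 * √M) + √M / 2)) := by
    refine mul_le_mul_of_nonneg_left (hwε.trans ?_) (by positivity)
    exact mul_le_mul_of_nonneg_left hyoung (by positivity)
  have h3 := mul_le_mul_of_nonneg_left
    (add_le_add h1 (add_le_add_right h2 (θ * (θ * κc * (κv * (τ * L + ∑ i, γ i) + 4)))))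
    (sq_nonneg b)
  refine (add_le_add_right h3 _).trans (le_of_eq ?_)
  ring

/-- Complexity bound on the average expected constraint violation
for the two-stepsize stochastic SQP method with pre-specified stepsizes. -/
theorem stmt10 {m n : ℕ} (hm : 1 ≤ m) (hmn : m ≤ n)
    {Ω : Type*} {m0 : MeasurableSpace Ω} (μ : Measure Ω) [IsProbabilityMeasure μ]
    (ℱ : Filtration ℕ m0)
    -- problem data
    (f : EuclideanSpace ℝ (Fin n) → ℝ)
    (gradf : EuclideanSpace ℝ (Fin n) → EuclideanSpace ℝ (Fin n))
    (c : EuclideanSpace ℝ (Fin n) → EuclideanSpace ℝ (Fin m))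
    (gradc : Fin m → EuclideanSpace ℝ (Fin n) → EuclideanSpace ℝ (Fin n))
    (flow L κg κc s ζ κH M ν θ κβ σ : ℝ) (γ : Fin m → ℝ)
    (hL : 0 < L) (hκg : 0 < κg) (hκc : 0 < κc) (hs : 0 < s) (hζ : 0 < ζ)
    (hκH : 0 < κH) (hM : 0 < M) (hθ : 0 < θ) (hκβ : 0 < κβ)
    (hσ : σ ∈ Set.Ioo (0 : ℝ) 1) (hγ : ∀ i, 0 < γ i)
    (hf : ∀ z, HasGradientAt f (gradf z) z)
    (hflow : ∀ z, flow ≤ f z)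
    (hfLip : ∀ z z', ‖gradf z - gradf z'‖ ≤ L * ‖z - z'‖)
    (hgradb : ∀ z, ‖gradf z‖ ≤ κg)
    (hc : ∀ i z, HasGradientAt (fun w => c w i) (gradc i z) z)
    (hcb : ∀ z, l1Norm (c z) ≤ κc)
    (hcLip : ∀ i z z', ‖gradc i z - gradc i z'‖ ≤ γ i * ‖z - z'‖)
    -- algorithm iterates
    (x0 : EuclideanSpace ℝ (Fin n))
    (x u utrue g v : ℕ → Ω → EuclideanSpace ℝ (Fin n))
    (y ytrue : ℕ → Ω → EuclideanSpace ℝ (Fin m))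
    (H : ℕ → Ω → Matrix (Fin n) (Fin n) ℝ)
    (α : ℕ → Ω → ℝ) (β : ℕ → ℝ)
    (hx0 : ∀ ω, x 0 ω = x0)
    (hxmeas : ∀ k, StronglyMeasurable[ℱ k] (x k))
    (hHmeas : ∀ k i j, StronglyMeasurable[ℱ k] (fun ω => H k ω i j))
    (hHnorm : ∀ k ω (z : EuclideanSpace ℝ (Fin n)),
      ‖Matrix.toEuclideanLin (H k ω) z‖ ≤ κH * ‖z‖)
    (hHpd : ∀ k ω (z : EuclideanSpace ℝ (Fin n)),
      Matrix.toEuclideanLin (Jmat gradc (x k ω)) z = 0 →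
      ζ * ‖z‖ ^ 2 ≤ ⟪z, Matrix.toEuclideanLin (H k ω) z⟫)
    (hsv : ∀ k ω (z : EuclideanSpace ℝ (Fin m)),
      s * ‖z‖ ≤ ‖Matrix.toEuclideanLin (Jmat gradc (x k ω))ᵀ z‖)
    (hgmeas : ∀ k, StronglyMeasurable[ℱ (k + 1)] (g k))
    (hgmean : ∀ k, μ[g k | ℱ k] =ᵐ[μ] fun ω => gradf (x k ω))
    (hgvarint : ∀ k, Integrable (fun ω => ‖g k ω - gradf (x k ω)‖ ^ 2) μ)
    (hgvar : ∀ k, ∀ᵐ ω ∂μ,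
      (μ[fun ω' => ‖g k ω' - gradf (x k ω')‖ ^ 2 | ℱ k]) ω ≤ M)
    (humeas : ∀ k, StronglyMeasurable[ℱ (k + 1)] (u k))
    (hymeas : ∀ k, StronglyMeasurable[ℱ (k + 1)] (y k))
    (hvmeas : ∀ k, StronglyMeasurable[ℱ k] (v k))
    (hutmeas : ∀ k, StronglyMeasurable[ℱ k] (utrue k))
    (hytmeas : ∀ k, StronglyMeasurable[ℱ k] (ytrue k))
    (hJu : ∀ k ω, Matrix.toEuclideanLin (Jmat gradc (x k ω)) (u k ω) = 0)
    (hvrange : ∀ k ω, ∃ z : EuclideanSpace ℝ (Fin m),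
      v k ω = Matrix.toEuclideanLin (Jmat gradc (x k ω))ᵀ z)
    (hJp : ∀ k ω, Matrix.toEuclideanLin (Jmat gradc (x k ω)) (u k ω + v k ω)
      = -(c (x k ω)))
    (hsys : ∀ k ω, Matrix.toEuclideanLin (H k ω) (u k ω + v k ω)
      + Matrix.toEuclideanLin (Jmat gradc (x k ω))ᵀ (y k ω) = -(g k ω))
    (hJut : ∀ k ω, Matrix.toEuclideanLin (Jmat gradc (x k ω)) (utrue k ω) = 0)
    (hsyst : ∀ k ω, Matrix.toEuclideanLin (H k ω) (utrue k ω + v k ω)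
      + Matrix.toEuclideanLin (Jmat gradc (x k ω))ᵀ (ytrue k ω) = -(gradf (x k ω)))
    (hβpos : ∀ k, 0 < β k) (hβb : ∀ k, β k ≤ κβ)
    (hαmeas : ∀ k, StronglyMeasurable[ℱ (k + 1)] (α k))
    (hα : ∀ k ω, α k ω ∈ Set.Icc ν (ν + θ * β k))
    (hupdate : ∀ k ω, x (k + 1) ω = x k ω + α k ω • (β k • u k ω + v k ω))
    -- constants
    (κv κu τmin Γ κ₁ : ℝ)
    (hκv : κv = max (1 / s) (κc / s ^ 2))
    (hκu : κu = ζ⁻¹ * κg + ζ⁻¹ * κH * κv * κc)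
    (hΓ : Γ = ∑ i, γ i)
    (hτmin : τmin = (1 - σ) / (κv * (κβ * κH * κu + κg)))
    (hν : ν ∈ Set.Ioc (0 : ℝ) (σ / (2 * (κv * (τmin * L + Γ) + 4))))
    (hκ₁ : κ₁ = (ν + θ * κβ) ^ 2 * (τmin * L + Γ) * (ζ⁻¹ * κH * κu ^ 2 + ζ⁻¹ ^ 2 * M) / 2
      + θ * (θ * κc * (κv * (τmin * L + Γ) + 4) + τmin * κg * ζ⁻¹ * Real.sqrt M))
    (K : ℕ) (hK : 1 ≤ K) (η : ℝ) (hη : 0 < η)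
    (hηβ : η / Real.sqrt K ≤ κβ)
    (hβK : ∀ k < K, β k = η / Real.sqrt K)
    (κ₂ : ℝ) (hκ₂ : κ₂ = τmin * (f x0 - flow) + l1Norm (c x0) + η ^ 2 * κ₁) :
    (1 / (K : ℝ)) * ∑ k ∈ Finset.range K, ∫ ω, l1Norm (c (x k ω)) ∂μ
      ≤ 2 * κ₂ / (ν * σ * K) := by
  have : NeZero m := ⟨by omega⟩
  obtain ⟨hσ0, hσ1⟩ := hσ
  obtain ⟨hν0, hν1⟩ := hν
  have hκv0 : 0 < κv := hκv ▸ lt_max_of_lt_left (by positivity)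
  have hκu0 : 0 < κu := by rw [hκu]; positivity
  have hΓ0 : 0 < Γ := hΓ ▸ Finset.sum_pos (fun i _ => hγ i) Finset.univ_nonempty
  have hτ0 : 0 < τmin := by
    rw [hτmin]
    exact div_pos (by linarith) (by positivity)
  have hA0 : 0 < τmin * L + Γ := by positivity
  have hνσ : ν * (κv * (τmin * L + Γ) + 4) ≤ σ / 2 := by
    rw [le_div_iff₀ (by positivity)] at hν1
    linarith
  have hfcont : Continuous f := continuous_iff_continuousAt.2 fun z => (hf z).continuousAt
  have hgradcont : Continuous gradf :=
    (LipschitzWith.of_dist_le_mul (K := ⟨L, hL.le⟩) fun a b => by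
      rw [dist_eq_norm, dist_eq_norm]
      exact hfLip a b).continuous
  have hgradccont : ∀ i, Continuous (gradc i) := fun i =>
    (LipschitzWith.of_dist_le_mul (K := ⟨γ i, (hγ i).le⟩) fun a b => by
      rw [dist_eq_norm, dist_eq_norm]
      exact hcLip i a b).continuous
  have hccont : Continuous fun z => l1Norm (c z) :=
    continuous_finsetSum _ fun i _ =>
      (continuous_iff_continuousAt.2 fun z => (hc i z).continuousAt).abs
  set e : ℕ → Ω → EuclideanSpace ℝ (Fin n) := fun k ω => g k ω - gradf (x k ω) with hedef
  set w : ℕ → Ω → EuclideanSpace ℝ (Fin n) := fun k ω => u k ω - utrue k ω with hwdef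
  have hJw : ∀ k ω, Matrix.toEuclideanLin (Jmat gradc (x k ω)) (w k ω) = 0 := fun k ω => by
    rw [hwdef, map_sub, hJu, hJut, sub_zero]
  have hsysw : ∀ k ω, Matrix.toEuclideanLin (H k ω) (w k ω)
      + Matrix.toEuclideanLin (Jmat gradc (x k ω))ᵀ (y k ω - ytrue k ω) = -(e k ω) := by
    intro k ω
    have h1 := hsys k ω
    have h2 := hsyst k ω
    rw [map_add] at h1 h2
    simp only [hwdef, hedef, map_sub]
    rw [neg_sub', ← h1, ← h2]
    abel
  have hwle : ∀ k ω, ‖w k ω‖ ≤ ζ⁻¹ * ‖e k ω‖ := fun k ω => by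
    rw [inv_mul_eq_div, le_div_iff₀' hζ]
    exact tangential_norm_le (hHpd k ω) (hJw k ω) (hsysw k ω)
  have hJv : ∀ k ω, Matrix.toEuclideanLin (Jmat gradc (x k ω)) (v k ω) = -(c (x k ω)) :=
    fun k ω => by
      have := hJp k ω
      rwa [map_add, hJu, zero_add] at this
  have hbd := fun k ω => sqp_step_bounds hζ hs hκH.le hκg.le hκv hκu (hHnorm k ω) (hHpd k ω)
    (hsv k ω) (hgradb (x k ω)) (hcb (x k ω)) (hvrange k ω) (hJv k ω) (hJut k ω) (hsyst k ω)
  have hmodel : ∀ k ω, τmin * (β k * ⟪gradf (x k ω), utrue k ω⟫ + ⟪gradf (x k ω), v k ω⟫)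
      ≤ (1 - σ) * l1Norm (c (x k ω)) := fun k ω => by
    obtain ⟨-, -, -, h1, h2⟩ := hbd k ω
    have hC0 := l1Norm_nonneg (c (x k ω))
    calc _ ≤ τmin * (κβ * (κu * (κH * (κv * l1Norm (c (x k ω)))))
          + κg * (κv * l1Norm (c (x k ω)))) := by
          refine mul_le_mul_of_nonneg_left (add_le_add ?_ h2) hτ0.le
          exact (mul_le_mul_of_nonneg_left h1 (hβpos k).le).trans
            (mul_le_mul_of_nonneg_right (hβb k) (by positivity))
      _ = τmin * (κv * (κβ * κH * κu + κg)) * l1Norm (c (x k ω)) := by ring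
      _ = (1 - σ) * l1Norm (c (x k ω)) := by
          rw [hτmin, div_mul_cancel₀ _ (by positivity)]
  have hem : ∀ k, StronglyMeasurable (e k) := fun k =>
    ((hgmeas k).mono (ℱ.le _)).sub
      ((hgradcont.comp_stronglyMeasurable (hxmeas k)).mono (ℱ.le _))
  have hei : ∀ k, Integrable (e k) μ := fun k =>
    ((memLp_two_iff_integrable_sq_norm (hem k).aestronglyMeasurable).2 (hgvarint k)).integrable
      one_le_two
  have hgradi : ∀ k, Integrable (fun ω => gradf (x k ω)) μ := fun k =>
    Integrable.of_bound
      ((hgradcont.comp_stronglyMeasurable (hxmeas k)).mono (ℱ.le _)).aestronglyMeasurable κg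
      (ae_of_all _ fun ω => hgradb _)
  have hce : ∀ k, μ[e k | ℱ k] =ᵐ[μ] 0 := fun k => by
    have hgi : Integrable (g k) μ :=
      ((hei k).add (hgradi k)).congr (ae_of_all _ fun ω => by simp [hedef])
    have h1 := condExp_sub hgi (hgradi k) (ℱ k)
    rw [condExp_of_stronglyMeasurable (ℱ.le k)
      (hgradcont.comp_stronglyMeasurable (hxmeas k)) (hgradi k)] at h1
    filter_upwards [h1, hgmean k] with ω h2 h3
    refine h2.trans ?_
    simp [h3]
  have hwm : ∀ k, StronglyMeasurable (w k) := fun k =>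
    ((humeas k).mono (ℱ.le _)).sub ((hutmeas k).mono (ℱ.le _))
  have horth : ∀ (k : ℕ) (b : Ω → EuclideanSpace ℝ (Fin n)) (B : ℝ), StronglyMeasurable[ℱ k] b →
      (∀ ω, ‖b ω‖ ≤ B) →
      Integrable (fun ω => ⟪b ω, w k ω⟫) μ ∧ ∫ ω, ⟪b ω, w k ω⟫ ∂μ = 0 := by
    intro k b B hb hB
    have hint : Integrable (fun ω => ⟪b ω, w k ω⟫) μ := by
      refine ((hei k).norm.const_mul (B * ζ⁻¹)).mono'
        ((hb.mono (ℱ.le _)).inner (hwm k)).aestronglyMeasurable (ae_of_all _ fun ω => ?_)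
      refine (norm_inner_le_norm _ _).trans ?_
      rw [mul_assoc]
      exact mul_le_mul (hB ω) (hwle k ω) (norm_nonneg _) ((norm_nonneg _).trans (hB ω))
    obtain ⟨a, ha, hab⟩ := exists_stronglyMeasurable_inner_saddle_eq (m0 := ℱ k) hζ hs
      (H := H k) (J := fun ω => Jmat gradc (x k ω)) (hHmeas k)
      (fun i j => ((EuclideanSpace.proj j).continuous.comp
        (hgradccont i)).comp_stronglyMeasurable (hxmeas k)) (hHpd k) (hsv k) hb
    have heq : (fun ω => ⟪b ω, w k ω⟫) = fun ω => -⟪a ω, e k ω⟫ := funext fun ω => by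
      rw [hab ω _ _ _ (hJw k ω) (hsysw k ω), inner_neg_right]
    refine ⟨hint, ?_⟩
    rw [heq, integral_neg, integral_inner_eq_zero_of_condExp_eq_zero (ℱ.le k) ha (hei k) ?_ (hce k),
      neg_zero]
    rw [heq] at hint
    exact integrable_neg_iff.1 hint
  have hgw := fun k => horth k (fun ω => gradf (x k ω)) κg
    (hgradcont.comp_stronglyMeasurable (hxmeas k)) (fun ω => hgradb _)
  have hutw := fun k => horth k (utrue k) κu (hutmeas k) fun ω => (hbd k ω).2.1
  have hvar : ∀ k, ∫ ω, ‖e k ω‖ ^ 2 ∂μ ≤ M := fun k => by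
    rw [← integral_condExp (ℱ.le k)]
    calc _ ≤ ∫ _, M ∂μ := integral_mono_ae integrable_condExp (integrable_const M) (hgvar k)
      _ = M := by simp
  have hCi : ∀ k, Integrable (fun ω => l1Norm (c (x k ω))) μ := fun k =>
    Integrable.of_bound
      ((hccont.comp_stronglyMeasurable (hxmeas k)).mono (ℱ.le _)).aestronglyMeasurable κc
      (ae_of_all _ fun ω => by
        rw [Real.norm_eq_abs, abs_of_nonneg (l1Norm_nonneg _)]
        exact hcb _)
  set Φ : ℕ → Ω → ℝ := fun k ω => τmin * f (x k ω) + l1Norm (c (x k ω)) with hΦ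
  have hΦm : ∀ k, StronglyMeasurable (Φ k) := fun k =>
    (((continuous_const.mul hfcont).add hccont).comp_stronglyMeasurable (hxmeas k)).mono (ℱ.le _)
  have hM' : 0 < √M := Real.sqrt_pos.2 hM
  set a₀ := (ν + θ * κβ) ^ 2 * (τmin * L + Γ) / 2 * (ζ⁻¹ * κH * κu ^ 2)
    + θ * (θ * κc * (κv * (τmin * L + Γ) + 4)) + θ * τmin * κg * ζ⁻¹ * √M / 2 with ha₀
  set a₁ := (ν + θ * κβ) ^ 2 * (τmin * L + Γ) / 2 * ζ⁻¹ ^ 2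
    + θ * τmin * κg * ζ⁻¹ / (2 * √M) with ha₁
  have ha₁0 : 0 ≤ a₁ := by positivity
  have hconst : a₀ + a₁ * M = κ₁ := by
    have h1 : θ * τmin * κg * ζ⁻¹ / (2 * √M) * M = θ * τmin * κg * ζ⁻¹ * √M / 2 := by
      nth_rewrite 2 [← Real.mul_self_sqrt hM.le]
      field_simp
    rw [ha₀, ha₁, add_mul, h1, hκ₁]
    ring
  have hstep : ∀ k ω, Φ (k + 1) ω ≤ Φ k ω - ν * σ / 2 * l1Norm (c (x k ω))
      + ν * τmin * β k * ⟪gradf (x k ω), w k ω⟫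
      + β k ^ 2 * ((ν + θ * κβ) ^ 2 * (τmin * L + Γ)) * ⟪utrue k ω, w k ω⟫
      + β k ^ 2 * a₁ * ‖e k ω‖ ^ 2 + β k ^ 2 * a₀ := by
    intro k ω
    have hu : u k ω = utrue k ω + w k ω := (add_sub_cancel _ _).symm
    simp only [hΦ, ha₀, ha₁, hupdate, hu, hΓ]
    obtain ⟨h1, -, h2, -, -⟩ := hbd k ω
    exact merit_step_le hf hfLip hc hcLip hτ0.le (hΓ ▸ hA0.le) hκv0.le hθ.le hν0 hκg.le hσ0.le hζ
      hM (hβpos k) (hβb k) (hα k ω).1 (hα k ω).2 (hΓ ▸ hνσ) (hgradb _) (hcb _)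
      (hu ▸ hJu k ω) (hvrange k ω) (hJv k ω) h1 h2 (hwle k ω) (hmodel k ω)
  have hΦlow : ∀ k ω, τmin * flow ≤ Φ k ω := fun k ω =>
    (mul_le_mul_of_nonneg_left (hflow _) hτ0.le).trans
      (le_add_of_nonneg_right (l1Norm_nonneg _))
  have hΦi : ∀ k, Integrable (Φ k) μ := by
    intro k
    induction k with
    | zero =>
      simp only [hΦ, hx0]
      exact integrable_const _
    | succ k ih =>
      have i1 := hCi k
      have i2 := (hgw k).1
      have i3 := (hutw k).1
      have i4 := hgvarint k
      exact integrable_of_le_of_le (hΦm _).aestronglyMeasurable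
        (ae_of_all _ (hΦlow (k + 1))) (ae_of_all _ (hstep k)) (integrable_const _) (by fun_prop)
  have hdecr : ∀ k, ν * σ / 2 * ∫ ω, l1Norm (c (x k ω)) ∂μ
      ≤ (∫ ω, Φ k ω ∂μ) - (∫ ω, Φ (k + 1) ω ∂μ) + β k ^ 2 * κ₁ := by
    intro k
    have h := integral_le_of_le_add_error (hΦi (k + 1)) (hΦi k) (hCi k) (hgw k).1 (hutw k).1
      (hgvarint k) (hgw k).2 (hutw k).2 (hvar k) (mul_nonneg (sq_nonneg (β k)) ha₁0) (hstep k)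
    rw [← hconst]
    linarith
  have hK0 : (0 : ℝ) < K := by exact_mod_cast hK
  have hsum := Finset.sum_le_sum fun k (_ : k ∈ Finset.range K) => hdecr k
  have hβsum : ∑ k ∈ Finset.range K, β k ^ 2 * κ₁ = η ^ 2 * κ₁ := by
    rw [Finset.sum_congr rfl fun k hk => by rw [hβK k (Finset.mem_range.1 hk)], Finset.sum_const,
      Finset.card_range, nsmul_eq_mul, div_pow, Real.sq_sqrt hK0.le]
    field_simp
  rw [Finset.sum_add_distrib, Finset.sum_range_sub' (fun k => ∫ ω, Φ k ω ∂μ), hβsum,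
    ← Finset.mul_sum] at hsum
  have hΦ0 : ∫ ω, Φ 0 ω ∂μ = τmin * f x0 + l1Norm (c x0) := by
    simp [hΦ, hx0]
  have hΦK : τmin * flow ≤ ∫ ω, Φ K ω ∂μ := by
    calc τmin * flow = ∫ _, τmin * flow ∂μ := by simp
      _ ≤ _ := integral_mono (integrable_const _) (hΦi K) (hΦlow K)
  rw [one_div_mul_eq_div, div_le_div_iff₀ hK0 (by positivity), hκ₂]
  rw [hΦ0] at hsum
  have h := mul_le_mul_of_nonneg_left hsum (mul_nonneg zero_le_two hK0.le)
  have hΦK' := mul_le_mul_of_nonneg_left hΦK (mul_nonneg zero_le_two hK0.le)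
  linarith
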